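/- For all α, β ∈ SL₂(ℤ) one has A(RαR, RβR)·A(α, βR) = A(R, αβR)·A(R, βR)·B(α). -/

import Mathlib

open Matrix

noncomputable section

abbrev GL2Z := GL (Fin 2) ℤ

/-- The Hilbert symbol at the infinite place of `ℚ`:
`(a,b) = -1` if `a < 0` and `b < 0`, and `(a,b) = 1` otherwise. -/
def hilb (a b : ℚ) : ℤˣ := if a < 0 ∧ b < 0 then -1 else 1

/-- Kubota's function `χ`: for `γ = [[a,b],[c,d]]`, `χ(γ) = c` if `c ≠ 0`, else `χ(γ) = d`. -/
def chi (γ : GL2Z) : ℤ :=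
  if (γ : Matrix (Fin 2) (Fin 2) ℤ) 1 0 = 0 then (γ : Matrix (Fin 2) (Fin 2) ℤ) 1 1
  else (γ : Matrix (Fin 2) (Fin 2) ℤ) 1 0

/-- The determinant of an element of `GL₂(ℤ)`, as an integer. -/
def detZ (γ : GL2Z) : ℤ := ((γ : Matrix (Fin 2) (Fin 2) ℤ)).det

/-- Kubota's twisted 2-cocycle
`A(α,β) = (det α, det β)·(χ(αβ)/χ(α), χ(αβ)/(χ(β)·det α))`. -/
def KA (α β : GL2Z) : ℤˣ :=
  hilb (detZ α) (detZ β) *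
    hilb ((chi (α * β) : ℚ) / (chi α : ℚ))
      ((chi (α * β) : ℚ) / ((chi β : ℚ) * (detZ α : ℚ)))

/-- The matrix `R = [[-1,0],[0,1]]` as an element of `GL₂(ℤ)`. -/
def Rm : GL2Z :=
  ⟨!![-1, 0; 0, 1], !![-1, 0; 0, 1],
    by rw [Matrix.mul_fin_two, Matrix.one_fin_two]; norm_num,
    by rw [Matrix.mul_fin_two, Matrix.one_fin_two]; norm_num⟩

/-- `B(γ) = (χ(γ), χ(γR))`. -/
def KB (γ : GL2Z) : ℤˣ := hilb (chi γ) (chi (γ * Rm))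

theorem detZ_mul (α β : GL2Z) : detZ (α * β) = detZ α * detZ β := by
  simp [detZ]

theorem detZ_Rm : detZ Rm = -1 := by
  simp [detZ, Rm]

theorem Rm_mul_Rm : Rm * Rm = 1 := by
  ext i j
  fin_cases i <;> fin_cases j <;> simp [Rm]

theorem chi_Rm : chi Rm = 1 := by
  simp [chi, Rm]

theorem chi_Rm_mul (γ : GL2Z) : chi (Rm * γ) = chi γ := by
  simp [chi, Rm, Matrix.mul_apply, Fin.sum_univ_two]

theorem chi_mul_Rm (γ : GL2Z) :
    chi (γ * Rm) =
      if (γ : Matrix (Fin 2) (Fin 2) ℤ) 1 0 = 0 then chi γ else -chi γ := by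
  by_cases h : (γ : Matrix (Fin 2) (Fin 2) ℤ) 1 0 = 0 <;>
    simp [chi, Rm, Matrix.mul_apply, Fin.sum_univ_two, h]

theorem chi_ne_zero (γ : GL2Z) : chi γ ≠ 0 := by
  have hdet : ((γ : Matrix (Fin 2) (Fin 2) ℤ)).det ≠ 0 :=
    ((Matrix.isUnit_iff_isUnit_det _).mp γ.isUnit).ne_zero
  rw [Matrix.det_fin_two] at hdet
  unfold chi
  split_ifs with h
  · intro h'
    simp [h, h'] at hdet
  · exact h

/-- Left multiplication by an upper triangular `α` scales the bottom row by `χ(α)`. -/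
theorem chi_mul_of_apply_eq_zero (α β : GL2Z)
    (h : (α : Matrix (Fin 2) (Fin 2) ℤ) 1 0 = 0) : chi (α * β) = chi α * chi β := by
  have hd : (α : Matrix (Fin 2) (Fin 2) ℤ) 1 1 ≠ 0 := by
    simpa [chi, h] using chi_ne_zero α
  simp [chi, Matrix.mul_apply, Fin.sum_univ_two, h, hd]

theorem hilb_mul_self (a b : ℚ) : hilb a b * hilb a b = 1 :=
  Int.units_mul_self _

theorem hilb_self_neg (a : ℚ) : hilb a (-a) = 1 := by
  unfold hilb
  rw [if_neg]
  rintro ⟨h₁, h₂⟩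
  linarith

theorem hilb_neg_mul_hilb {a : ℚ} (ha : a ≠ 0) (b : ℚ) :
    hilb (-a) b * hilb a b = hilb b (-1) := by
  rcases ha.lt_or_gt with h | h <;> by_cases hb : b < 0 <;>
    simp [hilb, h, hb, h.not_gt]

theorem hilb_mul_left {a b : ℚ} (ha : a ≠ 0) (hb : b ≠ 0) (c : ℚ) :
    hilb (a * b) c = hilb a c * hilb b c := by
  by_cases hc : c < 0 <;> rcases ha.lt_or_gt with h | h <;> rcases hb.lt_or_gt with h' | h' <;>
    simp [hilb, hc, mul_neg_iff, h, h', h.not_gt, h'.not_gt]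

theorem hilb_self (a : ℚ) : hilb a a = hilb a (-1) := by
  simp [hilb]

theorem hilb_div_left {a b : ℚ} (ha : a ≠ 0) (hb : b ≠ 0) (c : ℚ) :
    hilb (a / b) c = hilb a c * hilb b c := by
  have h := hilb_mul_left (div_ne_zero ha hb) hb c
  rw [div_mul_cancel₀ a hb] at h
  rw [h, mul_assoc, hilb_mul_self, mul_one]

/-- Since `det R = -1` and `χ(Rγ) = χ(γ)`, the value `A(R,γ)` only depends on signs. -/
theorem KA_Rm_left (γ : GL2Z) : KA Rm γ = hilb (-1) (detZ γ) * hilb (chi γ) (-1) := by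
  have h : (chi γ : ℚ) ≠ 0 := Int.cast_ne_zero.mpr (chi_ne_zero γ)
  have h' : (chi γ : ℚ) / (chi γ * (-1)) = -1 := by field_simp
  simp only [KA, chi_Rm_mul, chi_Rm, detZ_Rm, Int.cast_one, Int.cast_neg, div_one, h']

theorem KA_of_detZ_left {α : GL2Z} (hα : detZ α = 1) (β : GL2Z) :
    KA α β = hilb ((chi (α * β) : ℚ) / chi α) ((chi (α * β) : ℚ) / chi β) := by
  have h : hilb 1 (detZ β) = 1 := if_neg fun h => absurd h.1 (by norm_num)
  simp [KA, hα, h]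

/-- For all `α, β ∈ SL₂(ℤ)`: `A(RαR, RβR)·A(α, βR) = A(R, αβR)·A(R, βR)·B(α)`. -/
theorem KA_identity_9 (α β : GL2Z) (hα : detZ α = 1) (hβ : detZ β = 1) :
    KA (Rm * α * Rm) (Rm * β * Rm) * KA α (β * Rm)
      = KA Rm (α * β * Rm) * KA Rm (β * Rm) * KB α := by
  have hx : (chi α : ℚ) ≠ 0 := Int.cast_ne_zero.mpr (chi_ne_zero α)
  have hy : (chi (β * Rm) : ℚ) ≠ 0 := Int.cast_ne_zero.mpr (chi_ne_zero _)
  have hz : (chi (α * β * Rm) : ℚ) ≠ 0 := Int.cast_ne_zero.mpr (chi_ne_zero _)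
  have hconj : Rm * α * Rm * (Rm * β * Rm) = Rm * (α * β * Rm) := by
    calc Rm * α * Rm * (Rm * β * Rm) = Rm * α * (Rm * Rm) * β * Rm := by simp only [mul_assoc]
      _ = Rm * (α * β * Rm) := by rw [Rm_mul_Rm]; simp only [mul_assoc, one_mul]
  have hdet : detZ (Rm * α * Rm) = 1 := by simp [detZ_mul, detZ_Rm, hα]
  have hsign : KA Rm (α * β * Rm) * KA Rm (β * Rm)
      = hilb (chi (α * β * Rm)) (-1) * hilb (chi (β * Rm)) (-1) := by
    rw [KA_Rm_left, KA_Rm_left, mul_mul_mul_comm, detZ_mul, detZ_mul, detZ_mul, hα, hβ, one_mul,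
      hilb_mul_self, one_mul]
  rw [hsign, KA_of_detZ_left hdet, KA_of_detZ_left hα, hconj, mul_assoc Rm α, mul_assoc Rm β,
    chi_Rm_mul, chi_Rm_mul, chi_Rm_mul, ← mul_assoc α, KB, chi_mul_Rm α]
  split_ifs with h
  · have hmul : (chi (α * β * Rm) : ℚ) = chi α * chi (β * Rm) := by
      rw [mul_assoc, chi_mul_of_apply_eq_zero α _ h, Int.cast_mul]
    rw [hilb_mul_self, hilb_self, hmul, hilb_mul_left hx hy, mul_assoc, mul_assoc,
      ← mul_assoc (hilb (chi (β * Rm)) (-1)), hilb_mul_self, one_mul, hilb_mul_self]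
  · rw [Int.cast_neg, hilb_self_neg, mul_one, div_neg, hilb_neg_mul_hilb (div_ne_zero hz hx),
      hilb_div_left hz hy]
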